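/- Let ℓ, H : I → ℝ and G₀ : ℓ(I)−ℓ(I) → ℝ be differentiable functions such that ℓ' does not vanish on I and H' is continuous. Then the triple (G₀, ℓ, H) satisfies G₀(ℓ(x)−ℓ(y)) = H((x+y)/2) − (H(x)+H(y))/2 for all x, y ∈ I if and only if there exist constants A, B, C, D, E, α, β ∈ ℝ with C·D·α ≠ 0 such that for all x ∈ I and all u ∈ ℓ(I)−ℓ(I) one of the following seven cases holds: (i) G₀(u) = 0, ℓ arbitrary, H(x) = Ax + B; (ii) G₀(u) = C(Du)², ℓ(x) = x/(2D) + E, H(x) = −Cx² + Ax + B; (iii) G₀(u) = C(Du)², ℓ(x) = e^{αx}/(2D) + E, H(x) = −(C/2)e^{2αx} + Ax + B; (iv) G₀(u) = C·ln(cosh(Du)), ℓ(x) = ln|αx+β|/(2D) + E, H(x) = C·ln|αx+β| + Ax + B, with 0 ∉ αI+β; (v) G₀(u) = C·ln(cosh(Du)), ℓ(x) = ln|tan(αx+β)|/(2D) + E, H(x) = C·ln|sin(2αx+2β)| + Ax + B, with ℤ ∩ (2/π)(αI+β) = ∅; (vi) G₀(u) = C·ln(cosh(Du)), ℓ(x)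 = ln|tanh(αx+β)|/(2D) + E, H(x) = C·ln|sinh(2αx+2β)| + Ax + B, with 0 ∉ αI+β; (vii) G₀(u) = C·ln(cos(Du)), ℓ(x) = arctan(tanh(αx+β))/D + E, H(x) = C·ln(cosh(2αx+2β)) + Ax + B. (In case (i) the condition CDα ≠ 0 is not required.) -/

import Mathlib

section

open Set Filter Topology

/-- `φ ((x + y) / 2)` is the mean of `φ x` and `φ y` with weights `f x` and `f y`. -/
def IsMidpointMean (I : Set ℝ) (f φ : ℝ → ℝ) : Prop :=
  ∀ x ∈ I, ∀ y ∈ I, φ ((x + y) / 2) * (f x + f y) = φ x * f x + φ y * f y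

lemma exists_eq_const_of_hasDerivAt_zero {I : Set ℝ} (hI : IsOpen I) (hc : I.OrdConnected)
    {u : ℝ → ℝ} (hu : ∀ x ∈ I, HasDerivAt u 0 x) : ∃ c, ∀ x ∈ I, u x = c :=
  hI.exists_is_const_of_deriv_eq_zero hc.isPreconnected
    (fun x hx => (hu x hx).differentiableAt.differentiableWithinAt) (fun x hx => (hu x hx).deriv)

lemma exists_eq_add_const_of_hasDerivAt {I : Set ℝ} (hI : IsOpen I) (hc : I.OrdConnected)
    {u v w : ℝ → ℝ} (hu : ∀ x ∈ I, HasDerivAt u (w x) x) (hv : ∀ x ∈ I, HasDerivAt v (w x) x) :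
    ∃ c, ∀ x ∈ I, u x = v x + c := by
  obtain ⟨c, hcc⟩ := exists_eq_const_of_hasDerivAt_zero hI hc (u := fun x => u x - v x)
    (fun x hx => by simpa using (hu x hx).fun_sub (hv x hx))
  exact ⟨c, fun x hx => by linarith [hcc x hx]⟩

lemma midpoint_mem {I : Set ℝ} (hc : I.OrdConnected) {x y : ℝ} (hx : x ∈ I) (hy : y ∈ I) :
    (x + y) / 2 ∈ I := by
  rcases le_total x y with h | h
  · exact hc.out hx hy ⟨by linarith, by linarith⟩
  · exact hc.out hy hx ⟨by linarith, by linarith⟩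

lemma exists_antideriv {I : Set ℝ} (hI : IsOpen I) (hc : I.OrdConnected) {f : ℝ → ℝ}
    (hf : ContinuousOn f I) : ∃ F : ℝ → ℝ, ∀ x ∈ I, HasDerivAt F (f x) x := by
  rcases I.eq_empty_or_nonempty with rfl | ⟨a, ha⟩
  · exact ⟨0, by simp⟩
  refine ⟨fun u => ∫ t in a..u, f t, fun x hx => ?_⟩
  have hs : uIcc a x ⊆ I := hc.uIcc_subset ha hx
  exact intervalIntegral.integral_hasDerivAt_right (hf.mono hs).intervalIntegrable
    (hf.stronglyMeasurableAtFilter hI x hx) (hf.continuousAt (hI.mem_nhds hx))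

namespace IsMidpointMean

variable {I : Set ℝ} {f φ : ℝ → ℝ}

lemma neg_left (h : IsMidpointMean I f φ) : IsMidpointMean I (fun x => -f x) φ := by
  intro x hx y hy
  linear_combination -h x hx y hy

lemma neg_right (h : IsMidpointMean I f φ) : IsMidpointMean I f (fun x => -φ x) := by
  intro x hx y hy
  linear_combination -h x hx y hy

lemma eq_of_midpoint_eq (h : IsMidpointMean I f φ) (hf : ∀ x ∈ I, 0 < f x) {x y : ℝ}
    (hx : x ∈ I) (hy : y ∈ I) (hm : φ ((x + y) / 2) = φ x) : φ y = φ x := by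
  have := h x hx y hy
  rw [hm] at this
  have h2 : (φ y - φ x) * f y = 0 := by linear_combination -this
  rcases mul_eq_zero.1 h2 with h3 | h3
  · linarith
  · exact absurd h3 (hf y hy).ne'

lemma le_left_of_eq (h : IsMidpointMean I f φ) (hc : I.OrdConnected) (hf : ∀ x ∈ I, 0 < f x)
    (hφ : ContinuousOn φ I) {a b : ℝ} (ha : a ∈ I) (hb : b ∈ I) (hab : a ≤ b) (he : φ a = φ b) :
    ∀ x ∈ Icc a b, φ x ≤ φ a := by
  have hs : Icc a b ⊆ I := hc.out ha hb
  obtain ⟨z, hz, hmax⟩ := isCompact_Icc.exists_isMaxOn (nonempty_Icc.2 hab) (hφ.mono hs)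
  suffices hle : φ z ≤ φ a from fun x hx => (hmax hx).trans hle
  by_contra! hlt
  rcases le_total (z - a) (b - z) with ht | ht
  · have hy : 2 * z - a ∈ Icc a b := ⟨by linarith [hz.1], by linarith⟩
    have h1 := h a ha _ (hs hy)
    have h2 : φ (2 * z - a) ≤ φ z := hmax hy
    rw [show (a + (2 * z - a)) / 2 = z by ring] at h1
    nlinarith [hf a ha, hf _ (hs hy)]
  · have hy : 2 * z - b ∈ Icc a b := ⟨by linarith, by linarith [hz.2]⟩
    have h1 := h b hb _ (hs hy)
    have h2 : φ (2 * z - b) ≤ φ z := hmax hy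
    rw [show (b + (2 * z - b)) / 2 = z by ring] at h1
    nlinarith [hf b hb, hf _ (hs hy)]

lemma eq_left_of_eq (h : IsMidpointMean I f φ) (hc : I.OrdConnected) (hf : ∀ x ∈ I, 0 < f x)
    (hφ : ContinuousOn φ I) {a b : ℝ} (ha : a ∈ I) (hb : b ∈ I) (hab : a ≤ b) (he : φ a = φ b) :
    ∀ x ∈ Icc a b, φ x = φ a := by
  intro x hx
  have h1 := h.le_left_of_eq hc hf hφ ha hb hab he x hx
  have h2 := h.neg_right.le_left_of_eq hc hf hφ.neg ha hb hab (by simp [he]) x hx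
  linarith

lemma eq_of_eventually_eq (h : IsMidpointMean I f φ) (hc : I.OrdConnected)
    (hf : ∀ x ∈ I, 0 < f x) {a y : ℝ} (ha : a ∈ I) (hy : y ∈ I)
    (he : ∀ᶠ n : ℕ in atTop, φ (a + (y - a) / 2 ^ n) = φ a) : φ y = φ a := by
  obtain ⟨N, hN⟩ := eventually_atTop.1 he
  have key : ∀ n : ℕ, ∀ y ∈ I, φ (a + (y - a) / 2 ^ n) = φ a → φ y = φ a := by
    intro n
    induction n with
    | zero => intro y _ h1; simpa using h1
    | succ n ih =>
      intro y hy h1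
      refine h.eq_of_midpoint_eq hf ha hy (ih _ (midpoint_mem hc ha hy) ?_)
      rw [← h1]
      congr 1
      rw [pow_succ]
      field_simp
      ring
  exact key N y hy (hN N le_rfl)

lemma injOn_or_const (h : IsMidpointMean I f φ) (hc : I.OrdConnected) (hf : ∀ x ∈ I, 0 < f x)
    (hφ : ContinuousOn φ I) : InjOn φ I ∨ ∃ c, ∀ x ∈ I, φ x = c := by
  by_cases hinj : InjOn φ I
  · exact Or.inl hinj
  right
  obtain ⟨a, ha, b, hb, hab, he⟩ : ∃ a ∈ I, ∃ b ∈ I, a < b ∧ φ a = φ b := by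
    simp only [InjOn, not_forall] at hinj
    obtain ⟨a, ha, b, hb, he, hne⟩ := hinj
    rcases lt_or_gt_of_ne hne with h1 | h1
    · exact ⟨a, ha, b, hb, h1, he⟩
    · exact ⟨b, hb, a, ha, h1, he.symm⟩
  have hflat := h.eq_left_of_eq hc hf hφ ha hb hab.le he
  have hlim : ∀ p y : ℝ, Tendsto (fun n : ℕ => p + (y - p) / 2 ^ n) atTop (𝓝 p) := by
    intro p y
    have := (tendsto_pow_atTop_nhds_zero_of_lt_one (r := (1 / 2 : ℝ)) (by norm_num)
      (by norm_num)).const_mul (y - p)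
    simpa [div_eq_mul_inv] using this.const_add p
  refine ⟨φ a, fun y hy => ?_⟩
  rcases le_total a y with hay | hya
  · apply h.eq_of_eventually_eq hc hf ha hy
    filter_upwards [(hlim a y).eventually (gt_mem_nhds hab)] with n hn
    refine hflat _ ⟨?_, hn.le⟩
    have : 0 ≤ (y - a) / 2 ^ n := div_nonneg (by linarith) (by positivity)
    linarith
  · rw [he]
    apply h.eq_of_eventually_eq hc hf hb hy
    filter_upwards [(hlim b y).eventually (lt_mem_nhds hab)] with n hn
    rw [← he]
    refine hflat _ ⟨hn.le, ?_⟩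
    have : (y - b) / 2 ^ n ≤ 0 := div_nonpos_of_nonpos_of_nonneg (by linarith) (by positivity)
    linarith

lemma exists_ne {I : Set ℝ} (hI : IsOpen I) {y : ℝ} (hy : y ∈ I) : ∃ x ∈ I, x ≠ y := by
  obtain ⟨ε, hε, hb⟩ := Metric.isOpen_iff.1 hI y hy
  refine ⟨y + ε / 2, hb ?_, by linarith⟩
  rw [Metric.mem_ball, Real.dist_eq]
  rw [show y + ε / 2 - y = ε / 2 by ring, abs_of_pos (by linarith)]
  linarith

lemma contDiffOn_weight (h : IsMidpointMean I f φ) (hI : IsOpen I) (hc : I.OrdConnected)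
    (hinj : InjOn φ I) {n : ℕ} (hφ : ContDiffOn ℝ n φ I) : ContDiffOn ℝ n f I := by
  intro y hy
  obtain ⟨x, hx, hxy⟩ := exists_ne hI hy
  have hm := midpoint_mem hc hx hy
  have hφy : ContDiffAt ℝ n φ y := hφ.contDiffAt (hI.mem_nhds hy)
  have hφm : ContDiffAt ℝ n (fun t => φ ((x + t) / 2)) y :=
    ContDiffAt.comp (g := φ) (f := fun t => (x + t) / 2) y (hφ.contDiffAt (hI.mem_nhds hm))
      (by fun_prop)
  have hden : ∀ t ∈ I, t ≠ x → φ t - φ ((x + t) / 2) ≠ 0 := by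
    intro t ht htx h0
    have := hinj ht (midpoint_mem hc hx ht) (by linarith)
    exact htx (by linarith)
  have hq : ContDiffAt ℝ n
      (fun t => f x * (φ ((x + t) / 2) - φ x) / (φ t - φ ((x + t) / 2))) y :=
    (contDiffAt_const.mul (hφm.sub contDiffAt_const)).div (hφy.sub hφm) (hden y hy hxy.symm)
  refine (hq.congr_of_eventuallyEq ?_).contDiffWithinAt
  filter_upwards [hI.mem_nhds hy, isOpen_ne.mem_nhds hxy.symm] with t ht htx
  rw [eq_div_iff (hden t ht htx)]
  linear_combination -h x hx t ht

lemma contDiffOn_antideriv {I : Set ℝ} (hI : IsOpen I) {n : ℕ} {f F : ℝ → ℝ}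
    (hf : ContDiffOn ℝ n f I) (hF : ∀ x ∈ I, HasDerivAt F (f x) x) :
    ContDiffOn ℝ (n + 1 : ℕ) F I := by
  push_cast
  rw [contDiffOn_succ_iff_deriv_of_isOpen hI]
  exact ⟨fun x hx => (hF x hx).differentiableAt.differentiableWithinAt, by simp,
    hf.congr fun x hx => (hF x hx).deriv⟩

lemma hasDerivAt_sub_reflect {F : ℝ → ℝ} {f : ℝ → ℝ} {m t : ℝ}
    (h1 : HasDerivAt F (f (m + t)) (m + t)) (h2 : HasDerivAt F (f (m - t)) (m - t)) :
    HasDerivAt (fun t => F (m + t) - F (m - t)) (f (m + t) + f (m - t)) t := by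
  have := (h1.comp_const_add m t).fun_sub (h2.comp_const_sub m t)
  simpa using this

lemma hasDerivAt_add_reflect {F : ℝ → ℝ} {f : ℝ → ℝ} {m t : ℝ}
    (h1 : HasDerivAt F (f (m + t)) (m + t)) (h2 : HasDerivAt F (f (m - t)) (m - t)) :
    HasDerivAt (fun t => F (m + t) + F (m - t)) (f (m + t) - f (m - t)) t := by
  have := (h1.comp_const_add m t).fun_add (h2.comp_const_sub m t)
  simpa [sub_eq_add_neg] using this

lemma integrated (h : IsMidpointMean I f φ) (hc : I.OrdConnected) {F Γ : ℝ → ℝ}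
    (hF : ∀ x ∈ I, HasDerivAt F (f x) x) (hΓ : ∀ x ∈ I, HasDerivAt Γ (φ x * f x) x)
    {m T : ℝ} (hT : 0 ≤ T) (h1 : m - T ∈ I) (h2 : m + T ∈ I) :
    φ m * (F (m + T) - F (m - T)) = Γ (m + T) - Γ (m - T) := by
  have hmem : ∀ t ∈ Icc 0 T, m + t ∈ I ∧ m - t ∈ I := fun t ht =>
    ⟨hc.out h1 h2 ⟨by linarith [ht.1], by linarith [ht.2]⟩,
      hc.out h1 h2 ⟨by linarith [ht.2], by linarith [ht.1]⟩⟩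
  have hd : ∀ t ∈ Icc 0 T, HasDerivAt
      (fun t => φ m * (F (m + t) - F (m - t)) - (Γ (m + t) - Γ (m - t))) 0 t := by
    intro t ht
    obtain ⟨hp, hn⟩ := hmem t ht
    have := ((hasDerivAt_sub_reflect (hF _ hp) (hF _ hn)).const_mul (φ m)).fun_sub
      (hasDerivAt_sub_reflect (f := fun x => φ x * f x) (hΓ _ hp) (hΓ _ hn))
    refine this.congr_deriv ?_
    have he := h _ hp _ hn
    rw [show (m + t + (m - t)) / 2 = m by ring] at he
    linarith
  have := constant_of_has_deriv_right_zero
    (fun t ht => (hd t ht).continuousAt.continuousWithinAt)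
    (fun t ht => (hd t (Ico_subset_Icc_self ht)).hasDerivWithinAt) T (right_mem_Icc.2 hT)
  simp only [add_zero, sub_zero, sub_self, mul_zero] at this
  linarith

lemma contDiffOn_mean_succ (h : IsMidpointMean I f φ) (hI : IsOpen I) (hc : I.OrdConnected)
    (hf : ∀ x ∈ I, 0 < f x) {n : ℕ} (hφ : ContDiffOn ℝ n φ I) (hfn : ContDiffOn ℝ n f I) :
    ContDiffOn ℝ (n + 1 : ℕ) φ I := by
  obtain ⟨F, hF⟩ := exists_antideriv hI hc hfn.continuousOn
  obtain ⟨Γ, hΓ⟩ := exists_antideriv hI hc (hφ.continuousOn.mul hfn.continuousOn)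
  have hFc := contDiffOn_antideriv hI hfn hF
  have hΓc := contDiffOn_antideriv hI (hφ.mul hfn) hΓ
  have hmono : StrictMonoOn F I := by
    apply strictMonoOn_of_deriv_pos hc.convex
      (fun x hx => (hF x hx).continuousAt.continuousWithinAt)
    intro x hx
    rw [(hF x (interior_subset hx)).deriv]
    exact hf x (interior_subset hx)
  intro m hm
  obtain ⟨ε, hε, hb⟩ := Metric.isOpen_iff.1 hI m hm
  have hin : ∀ s ∈ Metric.ball m (ε / 2), s - ε / 2 ∈ I ∧ s + ε / 2 ∈ I := by
    intro s hs
    rw [Metric.mem_ball, Real.dist_eq, abs_lt] at hs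
    constructor <;> apply hb <;> rw [Metric.mem_ball, Real.dist_eq, abs_lt] <;>
      constructor <;> linarith
  have hm2 := hin m (Metric.mem_ball_self (by linarith))
  have hcp : ∀ {G : ℝ → ℝ}, ContDiffOn ℝ (n + 1 : ℕ) G I →
      ContDiffAt ℝ (n + 1 : ℕ) (fun s => G (s + ε / 2) - G (s - ε / 2)) m := fun {G} hG =>
    (ContDiffAt.comp (g := G) (f := fun s => s + ε / 2) m (hG.contDiffAt (hI.mem_nhds hm2.2))
      (by fun_prop)).sub
    (ContDiffAt.comp (g := G) (f := fun s => s - ε / 2) m (hG.contDiffAt (hI.mem_nhds hm2.1))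
      (by fun_prop))
  have hne : ∀ s ∈ Metric.ball m (ε / 2), F (s + ε / 2) - F (s - ε / 2) ≠ 0 := by
    intro s hs
    have := hmono (hin s hs).1 (hin s hs).2 (by linarith)
    linarith
  refine (((hcp hΓc).div (hcp hFc) (hne m (Metric.mem_ball_self (by linarith)))).congr_of_eventuallyEq
    ?_).contDiffWithinAt
  filter_upwards [Metric.ball_mem_nhds m (show 0 < ε / 2 by linarith)] with s hs
  rw [Pi.div_apply, eq_div_iff (hne s hs)]
  exact h.integrated hc hF hΓ (by linarith) (hin s hs).1 (hin s hs).2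

lemma contDiffOn (h : IsMidpointMean I f φ) (hI : IsOpen I) (hc : I.OrdConnected)
    (hf : ∀ x ∈ I, 0 < f x) (hφ : ContinuousOn φ I) (hinj : InjOn φ I) (n : ℕ) :
    ContDiffOn ℝ n φ I := by
  induction n with
  | zero => exact_mod_cast contDiffOn_zero.2 hφ
  | succ n ih => exact h.contDiffOn_mean_succ hI hc hf ih (h.contDiffOn_weight hI hc hinj ih)

lemma exists_hasDerivAt_two {I : Set ℝ} (hI : IsOpen I) {u : ℝ → ℝ} (hu : ContDiffOn ℝ (2 : ℕ) u I) :
    ∃ u₁ u₂ : ℝ → ℝ, (∀ x ∈ I, HasDerivAt u (u₁ x) x) ∧ ∀ x ∈ I, HasDerivAt u₁ (u₂ x) x := by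
  have h2 : ContDiffOn ℝ ((1 : ℕ) + 1) u I := by
    convert hu using 1
    norm_num
  rw [contDiffOn_succ_iff_deriv_of_isOpen hI] at h2
  have h1 : DifferentiableOn ℝ (deriv u) I := h2.2.2.differentiableOn (by simp)
  exact ⟨deriv u, deriv (deriv u),
    fun x hx => (h2.1.differentiableAt (hI.mem_nhds hx)).hasDerivAt,
    fun x hx => (h1.differentiableAt (hI.mem_nhds hx)).hasDerivAt⟩

lemma second_deriv (h : IsMidpointMean I f φ) (hI : IsOpen I) {f₁ f₂ g₁ g₂ : ℝ → ℝ}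
    (hf₁ : ∀ x ∈ I, HasDerivAt f (f₁ x) x) (hf₂ : ∀ x ∈ I, HasDerivAt f₁ (f₂ x) x)
    (hg₁ : ∀ x ∈ I, HasDerivAt (fun x => φ x * f x) (g₁ x) x)
    (hg₂ : ∀ x ∈ I, HasDerivAt g₁ (g₂ x) x) {x y : ℝ} (hx : x ∈ I) (hy : y ∈ I) :
    φ ((x + y) / 2) * (f₂ x + f₂ y) = g₂ x + g₂ y := by
  set m := (x + y) / 2 with hm
  set U : Set ℝ := {t | m + t ∈ I} ∩ {t | m - t ∈ I} with hU
  have hUo : IsOpen U := (hI.preimage (by fun_prop)).inter (hI.preimage (by fun_prop))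
  have e0 : ∀ t ∈ U, (fun t => φ m * (f (m + t) + f (m - t)) -
      (φ (m + t) * f (m + t) + φ (m - t) * f (m - t))) t = 0 := by
    intro t ht
    have he := h _ ht.1 _ ht.2
    rw [show (m + t + (m - t)) / 2 = m by ring] at he
    simp only
    linarith
  have e1 : ∀ t ∈ U, (fun t => φ m * (f₁ (m + t) - f₁ (m - t)) - (g₁ (m + t) - g₁ (m - t))) t = 0 := by
    intro t ht
    have d := ((hasDerivAt_add_reflect (hf₁ _ ht.1) (hf₁ _ ht.2)).const_mul (φ m)).sub
      (hasDerivAt_add_reflect (hg₁ _ ht.1) (hg₁ _ ht.2))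
    exact d.unique ((hasDerivAt_const t (0 : ℝ)).congr_of_eventuallyEq
      (by filter_upwards [hUo.mem_nhds ht] with s hs using e0 s hs))
  have ht : (x - y) / 2 ∈ U := by
    constructor
    · change (x + y) / 2 + (x - y) / 2 ∈ I
      convert hx using 1
      ring
    · change (x + y) / 2 - (x - y) / 2 ∈ I
      convert hy using 1
      ring
  have d := ((hasDerivAt_sub_reflect (hf₂ _ ht.1) (hf₂ _ ht.2)).const_mul (φ m)).sub
      (hasDerivAt_sub_reflect (hg₂ _ ht.1) (hg₂ _ ht.2))
  have e2 := d.unique ((hasDerivAt_const ((x - y) / 2) (0 : ℝ)).congr_of_eventuallyEq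
      (by filter_upwards [hUo.mem_nhds ht] with s hs using e1 s hs))
  rw [show m + (x - y) / 2 = x by rw [hm]; ring, show m - (x - y) / 2 = y by rw [hm]; ring] at e2
  linarith

theorem exists_ode_of_pos (h : IsMidpointMean I f φ) (hI : IsOpen I) (hc : I.OrdConnected)
    (hf : ∀ x ∈ I, 0 < f x) (hφ : ContinuousOn φ I) (hne : I.Nonempty) :
    (∃ c, ∀ x ∈ I, φ x = c) ∨ ∃ (f₁ : ℝ → ℝ) (γ c : ℝ), c ≠ 0 ∧
      (∀ x ∈ I, HasDerivAt f (f₁ x) x) ∧ (∀ x ∈ I, HasDerivAt f₁ (γ * f x) x) ∧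
      ∀ x ∈ I, HasDerivAt φ (c / f x ^ 2) x := by
  rcases h.injOn_or_const hc hf hφ with hinj | hconst
  swap
  · exact Or.inl hconst
  right
  have hφ2 := h.contDiffOn hI hc hf hφ hinj 2
  have hf2 := h.contDiffOn_weight hI hc hinj hφ2
  obtain ⟨f₁, f₂, hf₁, hf₂⟩ := exists_hasDerivAt_two hI hf2
  obtain ⟨g₁, g₂, hg₁, hg₂⟩ := exists_hasDerivAt_two hI (hφ2.mul hf2)
  have hsd : ∀ x ∈ I, ∀ y ∈ I, φ ((x + y) / 2) * (f₂ x + f₂ y) = g₂ x + g₂ y :=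
    fun x hx y hy => h.second_deriv hI hf₁ hf₂ hg₁ hg₂ hx hy
  have hdiag : ∀ x ∈ I, g₂ x = φ x * f₂ x := by
    intro x hx
    have := hsd x hx x hx
    rw [show (x + x) / 2 = x by ring] at this
    linarith
  obtain ⟨a, ha⟩ := hne
  have hγ : ∀ x ∈ I, f₂ x = f₂ a / f a * f x := by
    intro x hx
    rcases eq_or_ne x a with rfl | hxa
    · field_simp [(hf x hx).ne']
    have h1 := hsd x hx a ha
    rw [hdiag x hx, hdiag a ha] at h1
    have h2 := h x hx a ha
    have h3 : φ a - φ ((x + a) / 2) ≠ 0 := by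
      intro h0
      have := hinj ha (midpoint_mem hc hx ha) (by linarith)
      exact hxa (by linarith)
    have h4 : φ ((x + a) / 2) - φ x ≠ 0 := by
      intro h0
      have := hinj hx (midpoint_mem hc hx ha) (by linarith)
      exact hxa (by linarith)
    have h5 : f₂ x * f a = f₂ a * f x := by
      apply mul_left_cancel₀ (mul_ne_zero h3 h4)
      linear_combination (φ a - φ ((x + a) / 2)) * f a * h1 -
        (φ a - φ ((x + a) / 2)) * f₂ a * h2
    rw [div_mul_eq_mul_div, eq_div_iff (hf a ha).ne', h5]
  obtain ⟨c, hcc⟩ := exists_eq_const_of_hasDerivAt_zero hI hc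
    (u := fun x => g₁ x * f x - φ x * f x * f₁ x) (fun x hx => by
      have := ((hg₂ x hx).fun_mul (hf₁ x hx)).fun_sub ((hg₁ x hx).fun_mul (hf₂ x hx))
      refine this.congr_deriv ?_
      rw [hdiag x hx]
      ring)
  have hφd : ∀ x ∈ I, HasDerivAt φ (c / f x ^ 2) x := by
    intro x hx
    have d := (hg₁ x hx).div (hf₁ x hx) (hf x hx).ne'
    rw [hcc x hx] at d
    refine d.congr_of_eventuallyEq ?_
    filter_upwards [hI.mem_nhds hx] with t ht
    simp [(hf t ht).ne']
  refine ⟨f₁, f₂ a / f a, c, ?_, hf₁, fun x hx => hγ x hx ▸ hf₂ x hx, hφd⟩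
  rintro rfl
  obtain ⟨k, hk⟩ := exists_eq_const_of_hasDerivAt_zero hI hc
    (fun x hx => by simpa using hφd x hx)
  obtain ⟨b, hb, hba⟩ := exists_ne hI ha
  exact hba (hinj hb ha (by rw [hk b hb, hk a ha]))

theorem exists_ode (h : IsMidpointMean I f φ) (hI : IsOpen I) (hc : I.OrdConnected)
    (hf : (∀ x ∈ I, f x < 0) ∨ ∀ x ∈ I, 0 < f x) (hφ : ContinuousOn φ I) (hne : I.Nonempty) :
    (∃ c, ∀ x ∈ I, φ x = c) ∨ ∃ (f₁ : ℝ → ℝ) (γ c : ℝ), c ≠ 0 ∧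
      (∀ x ∈ I, HasDerivAt f (f₁ x) x) ∧ (∀ x ∈ I, HasDerivAt f₁ (γ * f x) x) ∧
      ∀ x ∈ I, HasDerivAt φ (c / f x ^ 2) x := by
  rcases hf with hf | hf
  · rcases h.neg_left.exists_ode_of_pos hI hc (fun x hx => neg_pos.2 (hf x hx)) hφ hne with
      h1 | ⟨f₁, γ, c, hc0, h1, h2, h3⟩
    · exact Or.inl h1
    · refine Or.inr ⟨fun x => -f₁ x, γ, c, hc0, fun x hx => ?_, fun x hx => ?_, fun x hx => ?_⟩
      · simpa using (h1 x hx).fun_neg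
      · simpa using (h2 x hx).fun_neg
      · simpa using h3 x hx
  · exact h.exists_ode_of_pos hI hc hf hφ hne

end IsMidpointMean

lemma mul_pos_of_continuousOn_of_ne_zero {I : Set ℝ} (hc : I.OrdConnected) {u : ℝ → ℝ}
    (hu : ContinuousOn u I) (h0 : ∀ x ∈ I, u x ≠ 0) {x y : ℝ} (hx : x ∈ I) (hy : y ∈ I) :
    0 < u x * u y := by
  by_contra! hle
  have hoc : (u '' I).OrdConnected := (hc.isPreconnected.image u hu).ordConnected
  have : (0 : ℝ) ∈ u '' I := by
    rcases mul_nonpos_iff.1 hle with h | h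
    · exact hoc.out (mem_image_of_mem u hy) (mem_image_of_mem u hx) ⟨h.2, h.1⟩
    · exact hoc.out (mem_image_of_mem u hx) (mem_image_of_mem u hy) h
  obtain ⟨z, hz, hz0⟩ := this
  exact h0 z hz hz0

lemma log_cosh_half_sub_log {p q : ℝ} (h : 0 < p * q) :
    Real.log (Real.cosh ((Real.log |p| - Real.log |q|) / 2)) =
      Real.log |p + q| - Real.log 2 - (Real.log |p| + Real.log |q|) / 2 := by
  have hp : p ≠ 0 := by rintro rfl; simp at h
  have hq : q ≠ 0 := by rintro rfl; simp at h
  have hs : |p + q| = |p| + |q| := by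
    rcases mul_pos_iff.1 h with ⟨h1, h2⟩ | ⟨h1, h2⟩
    · rw [abs_of_pos h1, abs_of_pos h2, abs_of_pos (by linarith)]
    · rw [abs_of_neg h1, abs_of_neg h2, abs_of_neg (by linarith)]; ring
  have hpe := Real.exp_log (abs_pos.2 hp)
  have hqe := Real.exp_log (abs_pos.2 hq)
  set a := Real.log |p|
  set b := Real.log |q|
  have hcosh : Real.cosh ((a - b) / 2) = |p + q| / 2 * Real.exp (-((a + b) / 2)) := by
    rw [Real.cosh_eq, hs, ← hpe, ← hqe, div_mul_eq_mul_div, add_mul, ← Real.exp_add, ← Real.exp_add]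
    congr 3 <;> ring
  have hpos : |p + q| ≠ 0 := by rw [hs]; positivity
  rw [hcosh, Real.log_mul (by positivity) (Real.exp_ne_zero _), Real.log_exp,
    Real.log_div hpos two_ne_zero]
  ring

lemma log_cosh_half_sub_log_tan {p q : ℝ} (hp : Real.sin (2 * p) ≠ 0) (hq : Real.sin (2 * q) ≠ 0)
    (hpq : Real.sin (p + q) ≠ 0) (h : 0 < Real.sin (2 * p) * Real.sin (2 * q)) :
    Real.log (Real.cosh ((Real.log |Real.tan p| - Real.log |Real.tan q|) / 2)) =
      Real.log |Real.sin (p + q)| -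
        (Real.log |Real.sin (2 * p)| + Real.log |Real.sin (2 * q)|) / 2 := by
  rw [Real.sin_two_mul] at hp hq h ⊢
  rw [Real.sin_two_mul] at h ⊢
  have hsp : Real.sin p ≠ 0 := by intro h0; simp [h0] at hp
  have hcp : Real.cos p ≠ 0 := by intro h0; simp [h0] at hp
  have hsq : Real.sin q ≠ 0 := by intro h0; simp [h0] at hq
  have hcq : Real.cos q ≠ 0 := by intro h0; simp [h0] at hq
  have ht : 0 < Real.tan p * Real.tan q := by
    have : Real.tan p * Real.tan q = 2 * Real.sin p * Real.cos p * (2 * Real.sin q * Real.cos q) *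
        (1 / (2 * Real.cos p * Real.cos q)) ^ 2 := by
      rw [Real.tan_eq_sin_div_cos, Real.tan_eq_sin_div_cos]
      field_simp
    rw [this]
    positivity
  have hadd : Real.tan p + Real.tan q = Real.sin (p + q) / (Real.cos p * Real.cos q) := by
    rw [Real.tan_eq_sin_div_cos, Real.tan_eq_sin_div_cos, Real.sin_add]
    field_simp
  rw [log_cosh_half_sub_log ht, hadd, Real.tan_eq_sin_div_cos, Real.tan_eq_sin_div_cos]
  simp only [Real.log_abs]
  rw [Real.log_div hpq (by positivity), Real.log_mul hcp hcq, Real.log_div hsp hcp,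
    Real.log_div hsq hcq, Real.log_mul (by positivity) hcp, Real.log_mul two_ne_zero hsp,
    Real.log_mul (by positivity) hcq, Real.log_mul two_ne_zero hsq]
  ring

lemma log_cosh_half_sub_log_tanh {p q : ℝ} (h : 0 < p * q) :
    Real.log (Real.cosh ((Real.log |Real.tanh p| - Real.log |Real.tanh q|) / 2)) =
      Real.log |Real.sinh (p + q)| -
        (Real.log |Real.sinh (2 * p)| + Real.log |Real.sinh (2 * q)|) / 2 := by
  have hsp : Real.sinh p ≠ 0 := by
    rw [Ne, Real.sinh_eq_zero]; rintro rfl; simp at h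
  have hsq : Real.sinh q ≠ 0 := by
    rw [Ne, Real.sinh_eq_zero]; rintro rfl; simp at h
  have hpq : Real.sinh (p + q) ≠ 0 := by
    rw [Ne, Real.sinh_eq_zero]; intro h0
    obtain rfl : q = -p := by linarith
    nlinarith [sq_nonneg p]
  have hcp := (Real.cosh_pos p).ne'
  have hcq := (Real.cosh_pos q).ne'
  have hss : 0 < Real.sinh p * Real.sinh q := by
    rcases mul_pos_iff.1 h with ⟨h1, h2⟩ | ⟨h1, h2⟩
    · exact mul_pos (Real.sinh_pos_iff.2 h1) (Real.sinh_pos_iff.2 h2)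
    · exact mul_pos_of_neg_of_neg (Real.sinh_neg_iff.2 h1) (Real.sinh_neg_iff.2 h2)
  have ht : 0 < Real.tanh p * Real.tanh q := by
    rw [Real.tanh_eq_sinh_div_cosh, Real.tanh_eq_sinh_div_cosh, div_mul_div_comm]
    exact div_pos hss (mul_pos (Real.cosh_pos p) (Real.cosh_pos q))
  have hadd : Real.tanh p + Real.tanh q = Real.sinh (p + q) / (Real.cosh p * Real.cosh q) := by
    rw [Real.tanh_eq_sinh_div_cosh, Real.tanh_eq_sinh_div_cosh, Real.sinh_add]
    field_simp
  rw [log_cosh_half_sub_log ht, hadd, Real.tanh_eq_sinh_div_cosh, Real.tanh_eq_sinh_div_cosh,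
    Real.sinh_two_mul, Real.sinh_two_mul]
  simp only [Real.log_abs]
  rw [Real.log_div hpq (by positivity), Real.log_mul hcp hcq, Real.log_div hsp hcp,
    Real.log_div hsq hcq, Real.log_mul (by positivity) hcp, Real.log_mul two_ne_zero hsp,
    Real.log_mul (by positivity) hcq, Real.log_mul two_ne_zero hsq]
  ring

lemma log_cos_sub_arctan_tanh (p q : ℝ) :
    Real.log (Real.cos (Real.arctan (Real.tanh p) - Real.arctan (Real.tanh q))) =
      Real.log (Real.cosh (p + q)) -
        (Real.log (Real.cosh (2 * p)) + Real.log (Real.cosh (2 * q))) / 2 := by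
  have hcp := Real.cosh_pos p
  have hcq := Real.cosh_pos q
  have hsqrt : ∀ r : ℝ, √(1 + Real.tanh r ^ 2) = √(Real.cosh (2 * r)) / Real.cosh r := by
    intro r
    have hr := Real.cosh_pos r
    rw [Real.tanh_eq_sinh_div_cosh, Real.cosh_two_mul, ← Real.sqrt_sq hr.le,
      ← Real.sqrt_div' _ (by positivity), Real.sqrt_sq hr.le]
    congr 1
    field_simp
  have h2p := Real.sqrt_pos.2 (Real.cosh_pos (2 * p))
  have h2q := Real.sqrt_pos.2 (Real.cosh_pos (2 * q))
  have : Real.cos (Real.arctan (Real.tanh p) - Real.arctan (Real.tanh q)) =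
      Real.cosh (p + q) / (√(Real.cosh (2 * p)) * √(Real.cosh (2 * q))) := by
    rw [Real.cos_sub, Real.cos_arctan, Real.cos_arctan, Real.sin_arctan, Real.sin_arctan,
      hsqrt, hsqrt, Real.tanh_eq_sinh_div_cosh, Real.tanh_eq_sinh_div_cosh, Real.cosh_add]
    field_simp
  rw [this, Real.log_div (Real.cosh_pos _).ne' (by positivity), Real.log_mul h2p.ne' h2q.ne',
    Real.log_sqrt (Real.cosh_pos _).le, Real.log_sqrt (Real.cosh_pos _).le]
  ring

section Verification

variable {I : Set ℝ} {ℓ H : ℝ → ℝ} {A B C D E α β : ℝ}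

lemma midpoint_gap_quadratic (hc : I.OrdConnected) (hD : D ≠ 0)
    (h : ∀ x ∈ I, ℓ x = x / (2 * D) + E ∧ H x = -C * x ^ 2 + A * x + B) {x y : ℝ}
    (hx : x ∈ I) (hy : y ∈ I) :
    H ((x + y) / 2) - (H x + H y) / 2 = C * (D * (ℓ x - ℓ y)) ^ 2 := by
  rw [(h x hx).1, (h y hy).1, (h x hx).2, (h y hy).2, (h _ (midpoint_mem hc hx hy)).2]
  field_simp
  ring

lemma midpoint_gap_exp (hc : I.OrdConnected) (hD : D ≠ 0)
    (h : ∀ x ∈ I, ℓ x = Real.exp (α * x) / (2 * D) + E ∧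
      H x = -(C / 2) * Real.exp (2 * α * x) + A * x + B) {x y : ℝ}
    (hx : x ∈ I) (hy : y ∈ I) :
    H ((x + y) / 2) - (H x + H y) / 2 = C * (D * (ℓ x - ℓ y)) ^ 2 := by
  rw [(h x hx).1, (h y hy).1, (h x hx).2, (h y hy).2, (h _ (midpoint_mem hc hx hy)).2,
    show 2 * α * ((x + y) / 2) = α * x + α * y by ring,
    show 2 * α * x = α * x + α * x by ring, show 2 * α * y = α * y + α * y by ring,
    Real.exp_add, Real.exp_add, Real.exp_add]
  field_simp
  ring

lemma midpoint_gap_log (hc : I.OrdConnected) (hD : D ≠ 0)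
    (h : ∀ x ∈ I, ℓ x = Real.log |α * x + β| / (2 * D) + E ∧
      H x = C * Real.log |α * x + β| + A * x + B) (h0 : ∀ x ∈ I, α * x + β ≠ 0) {x y : ℝ}
    (hx : x ∈ I) (hy : y ∈ I) :
    H ((x + y) / 2) - (H x + H y) / 2 = C * Real.log (Real.cosh (D * (ℓ x - ℓ y))) := by
  have hpos := mul_pos_of_continuousOn_of_ne_zero hc (by fun_prop) h0 hx hy
  have hne : α * x + β + (α * y + β) ≠ 0 := by
    have := h0 _ (midpoint_mem hc hx hy)
    contrapose! this
    linarith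
  rw [(h x hx).1, (h y hy).1, (h x hx).2, (h y hy).2, (h _ (midpoint_mem hc hx hy)).2]
  rw [show D * (Real.log |α * x + β| / (2 * D) + E - (Real.log |α * y + β| / (2 * D) + E)) =
    (Real.log |α * x + β| - Real.log |α * y + β|) / 2 by field_simp; ring,
    log_cosh_half_sub_log hpos,
    show α * ((x + y) / 2) + β = (α * x + β + (α * y + β)) / 2 by ring, Real.log_abs (_ / 2),
    Real.log_div hne two_ne_zero, Real.log_abs (_ + _ + _)]
  ring

lemma midpoint_gap_tan (hc : I.OrdConnected) (hD : D ≠ 0)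
    (h : ∀ x ∈ I, ℓ x = Real.log |Real.tan (α * x + β)| / (2 * D) + E ∧
      H x = C * Real.log |Real.sin (2 * α * x + 2 * β)| + A * x + B)
    (h0 : ∀ x ∈ I, Real.sin (2 * (α * x + β)) ≠ 0) {x y : ℝ}
    (hx : x ∈ I) (hy : y ∈ I) :
    H ((x + y) / 2) - (H x + H y) / 2 = C * Real.log (Real.cosh (D * (ℓ x - ℓ y))) := by
  have hpos := mul_pos_of_continuousOn_of_ne_zero hc
    (u := fun x => Real.sin (2 * (α * x + β))) (by fun_prop) h0 hx hy
  have hm : Real.sin (α * x + β + (α * y + β)) ≠ 0 := by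
    convert h0 _ (midpoint_mem hc hx hy) using 2
    ring
  rw [(h x hx).1, (h y hy).1, (h x hx).2, (h y hy).2, (h _ (midpoint_mem hc hx hy)).2]
  rw [show D * (Real.log |Real.tan (α * x + β)| / (2 * D) + E -
      (Real.log |Real.tan (α * y + β)| / (2 * D) + E)) =
    (Real.log |Real.tan (α * x + β)| - Real.log |Real.tan (α * y + β)|) / 2 by field_simp; ring,
    log_cosh_half_sub_log_tan (h0 x hx) (h0 y hy) hm hpos,
    show 2 * α * ((x + y) / 2) + 2 * β = α * x + β + (α * y + β) by ring,
    show 2 * α * x + 2 * β = 2 * (α * x + β) by ring,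
    show 2 * α * y + 2 * β = 2 * (α * y + β) by ring]
  ring

lemma midpoint_gap_tanh (hc : I.OrdConnected) (hD : D ≠ 0)
    (h : ∀ x ∈ I, ℓ x = Real.log |Real.tanh (α * x + β)| / (2 * D) + E ∧
      H x = C * Real.log |Real.sinh (2 * α * x + 2 * β)| + A * x + B)
    (h0 : ∀ x ∈ I, α * x + β ≠ 0) {x y : ℝ} (hx : x ∈ I) (hy : y ∈ I) :
    H ((x + y) / 2) - (H x + H y) / 2 = C * Real.log (Real.cosh (D * (ℓ x - ℓ y))) := by
  have hpos := mul_pos_of_continuousOn_of_ne_zero hc (by fun_prop) h0 hx hy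
  rw [(h x hx).1, (h y hy).1, (h x hx).2, (h y hy).2, (h _ (midpoint_mem hc hx hy)).2]
  rw [show D * (Real.log |Real.tanh (α * x + β)| / (2 * D) + E -
      (Real.log |Real.tanh (α * y + β)| / (2 * D) + E)) =
    (Real.log |Real.tanh (α * x + β)| - Real.log |Real.tanh (α * y + β)|) / 2 by field_simp; ring,
    log_cosh_half_sub_log_tanh hpos,
    show 2 * α * ((x + y) / 2) + 2 * β = α * x + β + (α * y + β) by ring,
    show 2 * α * x + 2 * β = 2 * (α * x + β) by ring,
    show 2 * α * y + 2 * β = 2 * (α * y + β) by ring]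
  ring

lemma midpoint_gap_arctan_tanh (hc : I.OrdConnected) (hD : D ≠ 0)
    (h : ∀ x ∈ I, ℓ x = Real.arctan (Real.tanh (α * x + β)) / D + E ∧
      H x = C * Real.log (Real.cosh (2 * α * x + 2 * β)) + A * x + B) {x y : ℝ}
    (hx : x ∈ I) (hy : y ∈ I) :
    H ((x + y) / 2) - (H x + H y) / 2 = C * Real.log (Real.cos (D * (ℓ x - ℓ y))) := by
  rw [(h x hx).1, (h y hy).1, (h x hx).2, (h y hy).2, (h _ (midpoint_mem hc hx hy)).2]
  rw [show D * (Real.arctan (Real.tanh (α * x + β)) / D + E -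
      (Real.arctan (Real.tanh (α * y + β)) / D + E)) =
    Real.arctan (Real.tanh (α * x + β)) - Real.arctan (Real.tanh (α * y + β)) by field_simp; ring,
    log_cos_sub_arctan_tanh,
    show 2 * α * ((x + y) / 2) + 2 * β = α * x + β + (α * y + β) by ring,
    show 2 * α * x + 2 * β = 2 * (α * x + β) by ring,
    show 2 * α * y + 2 * β = 2 * (α * y + β) by ring]
  ring

end Verification

section Ode

variable {I : Set ℝ} {f f₁ : ℝ → ℝ}

lemma eq_affine_of_ode (hI : IsOpen I) (hc : I.OrdConnected)
    (h1 : ∀ x ∈ I, HasDerivAt f (f₁ x) x) (h2 : ∀ x ∈ I, HasDerivAt f₁ 0 x) :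
    ∃ a b, ∀ x ∈ I, f x = a * x + b := by
  obtain ⟨a, ha⟩ := exists_eq_const_of_hasDerivAt_zero hI hc h2
  obtain ⟨b, hb⟩ := exists_eq_add_const_of_hasDerivAt hI hc h1 (v := fun x => a * x)
    (fun x hx => by simpa [ha x hx] using (hasDerivAt_id x).const_mul a)
  exact ⟨a, b, hb⟩

lemma hasDerivAt_exp_mul (k x : ℝ) :
    HasDerivAt (fun x => Real.exp (k * x)) (k * Real.exp (k * x)) x := by
  have := ((hasDerivAt_id x).const_mul k).exp
  simpa [mul_comm] using this

lemma exists_add_mul_eq_exp_of_ode (hI : IsOpen I) (hc : I.OrdConnected) (k : ℝ)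
    (h1 : ∀ x ∈ I, HasDerivAt f (f₁ x) x) (h2 : ∀ x ∈ I, HasDerivAt f₁ (k ^ 2 * f x) x) :
    ∃ a, ∀ x ∈ I, f₁ x + k * f x = a * Real.exp (k * x) := by
  obtain ⟨a, ha⟩ := exists_eq_const_of_hasDerivAt_zero hI hc
    (u := fun x => (f₁ x + k * f x) * Real.exp (-k * x)) (fun x hx => by
      refine (((h2 x hx).fun_add ((h1 x hx).const_mul k)).fun_mul
        (hasDerivAt_exp_mul (-k) x)).congr_deriv ?_
      ring)
  refine ⟨a, fun x hx => ?_⟩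
  rw [← ha x hx, mul_assoc, ← Real.exp_add]
  simp

lemma eq_exp_of_ode (hI : IsOpen I) (hc : I.OrdConnected) {k : ℝ} (hk : k ≠ 0)
    (h1 : ∀ x ∈ I, HasDerivAt f (f₁ x) x) (h2 : ∀ x ∈ I, HasDerivAt f₁ (k ^ 2 * f x) x) :
    ∃ a b, ∀ x ∈ I, f x = a * Real.exp (k * x) + b * Real.exp (-k * x) := by
  obtain ⟨a, ha⟩ := exists_add_mul_eq_exp_of_ode hI hc k h1 h2
  obtain ⟨b, hb⟩ := exists_add_mul_eq_exp_of_ode hI hc (-k) h1 (by simpa using h2)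
  refine ⟨a / (2 * k), -b / (2 * k), fun x hx => ?_⟩
  have e1 := ha x hx
  have e2 := hb x hx
  rw [neg_mul k x] at e2 ⊢
  field_simp
  linear_combination e1 - e2

lemma eq_sin_of_ode (hI : IsOpen I) (hc : I.OrdConnected) {k : ℝ} (hk : k ≠ 0)
    (h1 : ∀ x ∈ I, HasDerivAt f (f₁ x) x) (h2 : ∀ x ∈ I, HasDerivAt f₁ (-k ^ 2 * f x) x) :
    ∃ R δ, ∀ x ∈ I, f x = R * Real.sin (k * x + δ) := by
  have hs : ∀ x, HasDerivAt (fun x => Real.sin (k * x)) (k * Real.cos (k * x)) x := fun x => by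
    simpa [mul_comm] using ((hasDerivAt_id x).const_mul k).sin
  have hco : ∀ x, HasDerivAt (fun x => Real.cos (k * x)) (-(k * Real.sin (k * x))) x := fun x => by
    simpa [mul_comm] using ((hasDerivAt_id x).const_mul k).cos
  obtain ⟨u, hu⟩ := exists_eq_const_of_hasDerivAt_zero hI hc
    (u := fun x => k * (f x * Real.cos (k * x)) - f₁ x * Real.sin (k * x)) (fun x hx => by
      refine ((((h1 x hx).fun_mul (hco x)).const_mul k).fun_sub
        ((h2 x hx).fun_mul (hs x))).congr_deriv ?_
      ring)
  obtain ⟨v, hv⟩ := exists_eq_const_of_hasDerivAt_zero hI hc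
    (u := fun x => k * (f x * Real.sin (k * x)) + f₁ x * Real.cos (k * x)) (fun x hx => by
      refine ((((h1 x hx).fun_mul (hs x)).const_mul k).fun_add
        ((h2 x hx).fun_mul (hco x))).congr_deriv ?_
      ring)
  set z : ℂ := ⟨v, u⟩ with hz
  refine ⟨‖z‖ / k, z.arg, fun x hx => ?_⟩
  have e1 : ‖z‖ * Real.cos z.arg = v := Complex.norm_mul_cos_arg z
  have e2 : ‖z‖ * Real.sin z.arg = u := Complex.norm_mul_sin_arg z
  have e3 := hu x hx
  have e4 := hv x hx
  rw [Real.sin_add, div_mul_eq_mul_div, eq_div_iff hk]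
  linear_combination Real.cos (k * x) * e3 + Real.sin (k * x) * e4 - Real.sin (k * x) * e1
    - Real.cos (k * x) * e2 - k * f x * Real.sin_sq_add_cos_sq (k * x)

lemma exp_add_exp_eq_cosh {a b : ℝ} (hab : 0 < a * b) :
    ∃ R δ : ℝ, ∀ t, a * Real.exp t + b * Real.exp (-t) = R * Real.cosh (t + δ) := by
  have ha : a ≠ 0 := by rintro rfl; simp at hab
  have hb : b ≠ 0 := by rintro rfl; simp at hab
  have hq : 0 < a / b := by
    rw [show a / b = a * b / b ^ 2 by field_simp]; positivity
  set δ := Real.log (a / b) / 2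
  have hδ : Real.exp δ * Real.exp δ = a / b := by
    rw [← Real.exp_add, show δ + δ = Real.log (a / b) by simp [δ], Real.exp_log hq]
  refine ⟨2 * a / Real.exp δ, δ, fun t => ?_⟩
  rw [Real.cosh_eq, neg_add, Real.exp_add, Real.exp_add, Real.exp_neg δ]
  have h0 := Real.exp_ne_zero δ
  have hb' : b = a / (Real.exp δ * Real.exp δ) := by rw [hδ]; field_simp
  rw [hb']
  field_simp

lemma exp_add_exp_eq_sinh {a b : ℝ} (hab : a * b < 0) :
    ∃ R δ : ℝ, ∀ t, a * Real.exp t + b * Real.exp (-t) = R * Real.sinh (t + δ) := by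
  have ha : a ≠ 0 := by rintro rfl; simp at hab
  have hb : b ≠ 0 := by rintro rfl; simp at hab
  have hq : 0 < -a / b := by
    rw [show -a / b = -(a * b) / b ^ 2 by field_simp]
    exact div_pos (by linarith) (by positivity)
  set δ := Real.log (-a / b) / 2
  have hδ : Real.exp δ * Real.exp δ = -a / b := by
    rw [← Real.exp_add, show δ + δ = Real.log (-a / b) by simp [δ], Real.exp_log hq]
  refine ⟨2 * a / Real.exp δ, δ, fun t => ?_⟩
  rw [Real.sinh_eq, neg_add, Real.exp_add, Real.exp_add, Real.exp_neg δ]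
  have h0 := Real.exp_ne_zero δ
  have hb' : b = -a / (Real.exp δ * Real.exp δ) := by rw [hδ]; field_simp
  rw [hb']
  field_simp
  ring

end Ode

section Integration

variable {I : Set ℝ} {ℓ H f φ : ℝ → ℝ} {c : ℝ}

lemma eq_up_to_affine (hI : IsOpen I) (hc : I.OrdConnected) {L K κ : ℝ → ℝ}
    (hℓ : ∀ x ∈ I, HasDerivAt ℓ (1 / f x) x) (hH : ∀ x ∈ I, HasDerivAt H (φ x) x)
    (hφ : ∀ x ∈ I, HasDerivAt φ (c / f x ^ 2) x)
    (hL : ∀ x ∈ I, HasDerivAt L (1 / f x) x) (hK : ∀ x ∈ I, HasDerivAt K (κ x) x)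
    (hκ : ∀ x ∈ I, HasDerivAt κ (c / f x ^ 2) x) :
    ∃ A B E, ∀ x ∈ I, ℓ x = L x + E ∧ H x = K x + A * x + B := by
  obtain ⟨E, hE⟩ := exists_eq_add_const_of_hasDerivAt hI hc hℓ hL
  obtain ⟨A, hA⟩ := exists_eq_add_const_of_hasDerivAt hI hc hφ hκ
  obtain ⟨B, hB⟩ := exists_eq_add_const_of_hasDerivAt hI hc hH (v := fun x => K x + A * x)
    (fun x hx => by
      rw [hA x hx]
      simpa using (hK x hx).fun_add ((hasDerivAt_id x).const_mul A))
  exact ⟨A, B, E, fun x hx => ⟨hE x hx, hB x hx⟩⟩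

lemma hasDerivAt_affine (a b x : ℝ) : HasDerivAt (fun x => a * x + b) a x := by
  simpa using ((hasDerivAt_id x).const_mul a).add_const b

lemma hasDerivAt_tanh (x : ℝ) : HasDerivAt Real.tanh (1 / Real.cosh x ^ 2) x := by
  have hc := (Real.cosh_pos x).ne'
  have h : Real.tanh = fun x => Real.sinh x / Real.cosh x :=
    funext Real.tanh_eq_sinh_div_cosh
  rw [h]
  refine ((Real.hasDerivAt_sinh x).fun_div (Real.hasDerivAt_cosh x) hc).congr_deriv ?_
  congr 1
  linear_combination Real.cosh_sq_sub_sinh_sq x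

lemma eq_quadratic (hI : IsOpen I) (hc : I.OrdConnected)
    (hℓ : ∀ x ∈ I, HasDerivAt ℓ (1 / f x) x) (hH : ∀ x ∈ I, HasDerivAt H (φ x) x)
    (hφ : ∀ x ∈ I, HasDerivAt φ (c / f x ^ 2) x) {b : ℝ} (hb : b ≠ 0)
    (hf : ∀ x ∈ I, f x = b) :
    ∃ A B E, ∀ x ∈ I, ℓ x = x / (2 * (b / 2)) + E ∧
      H x = -(-c / (2 * b ^ 2)) * x ^ 2 + A * x + B := by
  refine eq_up_to_affine hI hc hℓ hH hφ (κ := fun x => c / b ^ 2 * x) (fun x hx => ?_)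
    (fun x hx => ?_) fun x hx => ?_
  · refine ((hasDerivAt_id x).div_const _).congr_deriv ?_
    rw [hf x hx]
    field_simp
  · refine ((hasDerivAt_pow 2 x).const_mul _).congr_deriv ?_
    field_simp
    simp
  · rw [hf x hx]
    simpa using (hasDerivAt_id x).const_mul (c / b ^ 2)

lemma eq_exp (hI : IsOpen I) (hc : I.OrdConnected)
    (hℓ : ∀ x ∈ I, HasDerivAt ℓ (1 / f x) x) (hH : ∀ x ∈ I, HasDerivAt H (φ x) x)
    (hφ : ∀ x ∈ I, HasDerivAt φ (c / f x ^ 2) x) {b α : ℝ} (hb : b ≠ 0) (hα : α ≠ 0)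
    (hf : ∀ x ∈ I, f x = b * Real.exp (-α * x)) :
    ∃ A B E, ∀ x ∈ I, ℓ x = Real.exp (α * x) / (2 * (α * b / 2)) + E ∧
      H x = -(-c / (2 * α ^ 2 * b ^ 2) / 2) * Real.exp (2 * α * x) + A * x + B := by
  refine eq_up_to_affine hI hc hℓ hH hφ
    (κ := fun x => c / (2 * α * b ^ 2) * Real.exp (2 * α * x)) (fun x hx => ?_)
    (fun x hx => ?_) fun x hx => ?_
  · refine ((hasDerivAt_exp_mul α x).div_const _).congr_deriv ?_
    rw [hf x hx, neg_mul, Real.exp_neg]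
    field_simp
  · refine ((hasDerivAt_exp_mul (2 * α) x).const_mul _).congr_deriv ?_
    field_simp
  · refine ((hasDerivAt_exp_mul (2 * α) x).const_mul _).congr_deriv ?_
    rw [hf x hx, neg_mul, Real.exp_neg, show 2 * α * x = α * x + α * x by ring, Real.exp_add]
    field_simp

lemma eq_log (hI : IsOpen I) (hc : I.OrdConnected)
    (hℓ : ∀ x ∈ I, HasDerivAt ℓ (1 / f x) x) (hH : ∀ x ∈ I, HasDerivAt H (φ x) x)
    (hφ : ∀ x ∈ I, HasDerivAt φ (c / f x ^ 2) x) {α β : ℝ} (hα : α ≠ 0)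
    (hf0 : ∀ x ∈ I, α * x + β ≠ 0) (hf : ∀ x ∈ I, f x = α * x + β) :
    ∃ A B E, ∀ x ∈ I, ℓ x = Real.log |α * x + β| / (2 * (α / 2)) + E ∧
      H x = -c / α ^ 2 * Real.log |α * x + β| + A * x + B := by
  simp only [Real.log_abs]
  refine eq_up_to_affine hI hc hℓ hH hφ
    (κ := fun x => -c / α * (α * x + β)⁻¹) (fun x hx => ?_)
    (fun x hx => ?_) fun x hx => ?_
  · have h0 := hf0 x hx
    refine (((hasDerivAt_affine α β x).log h0).div_const _).congr_deriv ?_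
    rw [hf x hx]
    field_simp
  · have h0 := hf0 x hx
    refine (((hasDerivAt_affine α β x).log h0).const_mul _).congr_deriv ?_
    field_simp
  · have h0 := hf0 x hx
    refine (((hasDerivAt_affine α β x).fun_inv h0).const_mul _).congr_deriv ?_
    rw [hf x hx]
    field_simp

lemma eq_log_tan (hI : IsOpen I) (hc : I.OrdConnected)
    (hℓ : ∀ x ∈ I, HasDerivAt ℓ (1 / f x) x) (hH : ∀ x ∈ I, HasDerivAt H (φ x) x)
    (hφ : ∀ x ∈ I, HasDerivAt φ (c / f x ^ 2) x) {R α β : ℝ} (hR : R ≠ 0) (hα : α ≠ 0)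
    (hf0 : ∀ x ∈ I, Real.sin (2 * α * x + 2 * β) ≠ 0)
    (hf : ∀ x ∈ I, f x = R * Real.sin (2 * α * x + 2 * β)) :
    ∃ A B E, ∀ x ∈ I, ℓ x = Real.log |Real.tan (α * x + β)| / (2 * (α * R)) + E ∧
      H x = -c / (4 * α ^ 2 * R ^ 2) * Real.log |Real.sin (2 * α * x + 2 * β)| + A * x + B := by
  simp only [Real.log_abs]
  refine eq_up_to_affine hI hc hℓ hH hφ
    (κ := fun x => -c / (2 * α * R ^ 2) *
      (Real.cos (2 * α * x + 2 * β) / Real.sin (2 * α * x + 2 * β))) (fun x hx => ?_)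
    (fun x hx => ?_) fun x hx => ?_
  · have h0 := hf0 x hx
    have he : 2 * α * x + 2 * β = 2 * (α * x + β) := by ring
    rw [he, Real.sin_two_mul] at h0
    have hs : Real.sin (α * x + β) ≠ 0 := by intro h; simp [h] at h0
    have hco : Real.cos (α * x + β) ≠ 0 := by intro h; simp [h] at h0
    have ht : Real.tan (α * x + β) ≠ 0 := by
      rw [Real.tan_eq_sin_div_cos]; exact div_ne_zero hs hco
    have hd : HasDerivAt (fun x => Real.tan (α * x + β)) (1 / Real.cos (α * x + β) ^ 2 * α) x :=
      HasDerivAt.comp (h₂ := Real.tan) x (Real.hasDerivAt_tan hco) (hasDerivAt_affine α β x)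
    refine ((hd.log ht).div_const _).congr_deriv ?_
    rw [hf x hx, he, Real.sin_two_mul, Real.tan_eq_sin_div_cos]
    field_simp
  · have h0 := hf0 x hx
    refine ((((hasDerivAt_affine (2 * α) (2 * β) x).sin).log h0).const_mul _).congr_deriv ?_
    field_simp
    ring
  · have h0 := hf0 x hx
    have hd := hasDerivAt_affine (2 * α) (2 * β) x
    refine ((hd.cos.fun_div hd.sin h0).const_mul _).congr_deriv ?_
    rw [hf x hx]
    have hid := Real.sin_sq_add_cos_sq (2 * α * x + 2 * β)
    generalize Real.sin (2 * α * x + 2 * β) = s at *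
    generalize Real.cos (2 * α * x + 2 * β) = k at *
    field_simp
    linear_combination c * hid

lemma eq_log_tanh (hI : IsOpen I) (hc : I.OrdConnected)
    (hℓ : ∀ x ∈ I, HasDerivAt ℓ (1 / f x) x) (hH : ∀ x ∈ I, HasDerivAt H (φ x) x)
    (hφ : ∀ x ∈ I, HasDerivAt φ (c / f x ^ 2) x) {R α β : ℝ} (hR : R ≠ 0) (hα : α ≠ 0)
    (hf0 : ∀ x ∈ I, Real.sinh (2 * α * x + 2 * β) ≠ 0)
    (hf : ∀ x ∈ I, f x = R * Real.sinh (2 * α * x + 2 * β)) :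
    ∃ A B E, ∀ x ∈ I, ℓ x = Real.log |Real.tanh (α * x + β)| / (2 * (α * R)) + E ∧
      H x = -c / (4 * α ^ 2 * R ^ 2) * Real.log |Real.sinh (2 * α * x + 2 * β)| + A * x + B := by
  simp only [Real.log_abs]
  refine eq_up_to_affine hI hc hℓ hH hφ
    (κ := fun x => -c / (2 * α * R ^ 2) *
      (Real.cosh (2 * α * x + 2 * β) / Real.sinh (2 * α * x + 2 * β))) (fun x hx => ?_)
    (fun x hx => ?_) fun x hx => ?_
  · have h0 := hf0 x hx
    have he : 2 * α * x + 2 * β = 2 * (α * x + β) := by ring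
    rw [he, Real.sinh_two_mul] at h0
    have hs : Real.sinh (α * x + β) ≠ 0 := by intro h; simp [h] at h0
    have hco : Real.cosh (α * x + β) ≠ 0 := (Real.cosh_pos _).ne'
    have ht : Real.tanh (α * x + β) ≠ 0 := by
      rw [Real.tanh_eq_sinh_div_cosh]; exact div_ne_zero hs hco
    have hd : HasDerivAt (fun x => Real.tanh (α * x + β)) (1 / Real.cosh (α * x + β) ^ 2 * α) x :=
      (hasDerivAt_tanh _).comp x (hasDerivAt_affine α β x)
    refine ((hd.log ht).div_const _).congr_deriv ?_
    rw [hf x hx, he, Real.sinh_two_mul, Real.tanh_eq_sinh_div_cosh]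
    field_simp
  · have h0 := hf0 x hx
    refine ((((hasDerivAt_affine (2 * α) (2 * β) x).sinh).log h0).const_mul _).congr_deriv ?_
    field_simp
    ring
  · have h0 := hf0 x hx
    have hd := hasDerivAt_affine (2 * α) (2 * β) x
    refine ((hd.cosh.fun_div hd.sinh h0).const_mul _).congr_deriv ?_
    rw [hf x hx]
    have hid := Real.cosh_sq_sub_sinh_sq (2 * α * x + 2 * β)
    generalize Real.sinh (2 * α * x + 2 * β) = s at *
    generalize Real.cosh (2 * α * x + 2 * β) = k at *
    field_simp
    linear_combination c * hid

lemma eq_arctan_tanh (hI : IsOpen I) (hc : I.OrdConnected)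
    (hℓ : ∀ x ∈ I, HasDerivAt ℓ (1 / f x) x) (hH : ∀ x ∈ I, HasDerivAt H (φ x) x)
    (hφ : ∀ x ∈ I, HasDerivAt φ (c / f x ^ 2) x) {R α β : ℝ} (hR : R ≠ 0) (hα : α ≠ 0)
    (hf : ∀ x ∈ I, f x = R * Real.cosh (2 * α * x + 2 * β)) :
    ∃ A B E, ∀ x ∈ I, ℓ x = Real.arctan (Real.tanh (α * x + β)) / (α * R) + E ∧
      H x = c / (4 * α ^ 2 * R ^ 2) * Real.log (Real.cosh (2 * α * x + 2 * β)) + A * x + B := by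
  refine eq_up_to_affine hI hc hℓ hH hφ
    (κ := fun x => c / (2 * α * R ^ 2) * Real.tanh (2 * α * x + 2 * β)) (fun x hx => ?_)
    (fun x hx => ?_) fun x hx => ?_
  · have he : 2 * α * x + 2 * β = 2 * (α * x + β) := by ring
    have hco : Real.cosh (α * x + β) ≠ 0 := (Real.cosh_pos _).ne'
    have hd : HasDerivAt (fun x => Real.tanh (α * x + β)) (1 / Real.cosh (α * x + β) ^ 2 * α) x :=
      (hasDerivAt_tanh _).comp x (hasDerivAt_affine α β x)
    refine (hd.arctan.div_const _).congr_deriv ?_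
    have hpos : Real.cosh (α * x + β) ^ 2 + Real.sinh (α * x + β) ^ 2 ≠ 0 := by positivity
    rw [hf x hx, he, Real.cosh_two_mul, Real.tanh_eq_sinh_div_cosh]
    field_simp
  · have h0 : Real.cosh (2 * α * x + 2 * β) ≠ 0 := (Real.cosh_pos _).ne'
    refine ((((hasDerivAt_affine (2 * α) (2 * β) x).cosh).log h0).const_mul _).congr_deriv ?_
    rw [Real.tanh_eq_sinh_div_cosh]
    field_simp
    ring
  · have h0 : Real.cosh (2 * α * x + 2 * β) ≠ 0 := (Real.cosh_pos _).ne'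
    have hd : HasDerivAt (fun x => Real.tanh (2 * α * x + 2 * β))
        (1 / Real.cosh (2 * α * x + 2 * β) ^ 2 * (2 * α)) x :=
      (hasDerivAt_tanh _).comp x (hasDerivAt_affine (2 * α) (2 * β) x)
    refine (hd.const_mul _).congr_deriv ?_
    rw [hf x hx]
    field_simp

end Integration

lemma isMidpointMean_inv_deriv {I : Set ℝ} (hI : IsOpen I) (hc : I.OrdConnected)
    {ℓ H G ℓ' φ : ℝ → ℝ} (hℓ : ∀ x ∈ I, HasDerivAt ℓ (ℓ' x) x)
    (hH : ∀ x ∈ I, HasDerivAt H (φ x) x)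
    (hG : ∀ x ∈ I, ∀ y ∈ I, DifferentiableAt ℝ G (ℓ x - ℓ y)) (h0 : ∀ x ∈ I, ℓ' x ≠ 0)
    (h : ∀ x ∈ I, ∀ y ∈ I, G (ℓ x - ℓ y) = H ((x + y) / 2) - (H x + H y) / 2) :
    IsMidpointMean I (fun x => (ℓ' x)⁻¹) φ := by
  intro x hx y hy
  have hGd := (hG x hx y hy).hasDerivAt
  have hHm := hH _ (midpoint_mem hc hx hy)
  set g := deriv G (ℓ x - ℓ y)
  have ex : g * ℓ' x = φ ((x + y) / 2) / 2 - φ x / 2 := by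
    have d1 : HasDerivAt (fun s => G (ℓ s - ℓ y)) (g * ℓ' x) x :=
      HasDerivAt.comp (h₂ := G) x hGd ((hℓ x hx).sub_const (ℓ y))
    have d2 : HasDerivAt (fun s => H ((s + y) / 2) - (H s + H y) / 2)
        (φ ((x + y) / 2) * (1 / 2) - φ x / 2) x :=
      (HasDerivAt.comp (h₂ := H) x hHm (((hasDerivAt_id x).add_const y).div_const 2)).fun_sub
        (((hH x hx).add_const (H y)).div_const 2)
    have := d1.unique (d2.congr_of_eventuallyEq
      (by filter_upwards [hI.mem_nhds hx] with s hs using h s hs y hy))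
    linarith
  have ey : -(g * ℓ' y) = φ ((x + y) / 2) / 2 - φ y / 2 := by
    have d1 : HasDerivAt (fun s => G (ℓ x - ℓ s)) (g * -ℓ' y) y :=
      HasDerivAt.comp (h₂ := G) y hGd ((hℓ y hy).const_sub (ℓ x))
    have d2 : HasDerivAt (fun s => H ((x + s) / 2) - (H x + H s) / 2)
        (φ ((x + y) / 2) * (1 / 2) - φ y / 2) y :=
      (HasDerivAt.comp (h₂ := H) y hHm (((hasDerivAt_id y).const_add x).div_const 2)).fun_sub
        (((hH y hy).const_add (H x)).div_const 2)
    have := d1.unique (d2.congr_of_eventuallyEq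
      (by filter_upwards [hI.mem_nhds hy] with s hs using h x hx s hs))
    linarith
  have hx0 := h0 x hx
  have hy0 := h0 y hy
  field_simp
  linear_combination -2 * ℓ' y * ex - 2 * ℓ' x * ey

end


/-- Let `ℓ, H : I → ℝ` and `G₀ : ℓ(I)−ℓ(I) → ℝ` be differentiable
functions such that `ℓ'` does not vanish on `I` and `H'` is continuous.  Then the triple
`(G₀, ℓ, H)` satisfies `G₀(ℓ(x)−ℓ(y)) = H((x+y)/2) − (H(x)+H(y))/2` for all `x, y ∈ I` if
and only if there exist constants `A, B, C, D, E, α, β` with `C·D·α ≠ 0` such that one of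
the seven cases (i)–(vii) listed in the paper holds (in case (i) the condition `CDα ≠ 0`
is not required). -/
theorem stmt19 (I : Set ℝ) (hIopen : IsOpen I) (hIconn : I.OrdConnected)
    (hIne : I.Nonempty) (ℓ H G₀ : ℝ → ℝ)
    (hℓ : ∀ x ∈ I, DifferentiableAt ℝ ℓ x)
    (hH : ∀ x ∈ I, DifferentiableAt ℝ H x)
    (hG₀ : ∀ t : ℝ, (∃ x ∈ I, ∃ y ∈ I, t = ℓ x - ℓ y) → DifferentiableAt ℝ G₀ t)
    (hℓ' : ∀ x ∈ I, deriv ℓ x ≠ 0)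
    (hH' : ContinuousOn (deriv H) I) :
    (∀ x ∈ I, ∀ y ∈ I,
        G₀ (ℓ x - ℓ y) = H ((x + y) / 2) - (H x + H y) / 2) ↔
      ∃ A B C D E α β : ℝ,
        -- case (i): G₀ = 0, ℓ arbitrary, H affine
        (((∀ t : ℝ, (∃ x ∈ I, ∃ y ∈ I, t = ℓ x - ℓ y) → G₀ t = 0) ∧
            (∀ x ∈ I, H x = A * x + B)) ∨
          (C * D * α ≠ 0 ∧
            -- case (ii)
            (((∀ t : ℝ, (∃ x ∈ I, ∃ y ∈ I, t = ℓ x - ℓ y) → G₀ t = C * (D * t) ^ 2) ∧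
                (∀ x ∈ I, ℓ x = x / (2 * D) + E ∧ H x = -C * x ^ 2 + A * x + B)) ∨
              -- case (iii)
              ((∀ t : ℝ, (∃ x ∈ I, ∃ y ∈ I, t = ℓ x - ℓ y) → G₀ t = C * (D * t) ^ 2) ∧
                (∀ x ∈ I, ℓ x = Real.exp (α * x) / (2 * D) + E ∧
                  H x = -(C / 2) * Real.exp (2 * α * x) + A * x + B)) ∨
              -- case (iv)
              ((∀ t : ℝ, (∃ x ∈ I, ∃ y ∈ I, t = ℓ x - ℓ y) →
                  G₀ t = C * Real.log (Real.cosh (D * t))) ∧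
                (∀ x ∈ I, ℓ x = Real.log |α * x + β| / (2 * D) + E ∧
                  H x = C * Real.log |α * x + β| + A * x + B) ∧
                (∀ x ∈ I, α * x + β ≠ 0)) ∨
              -- case (v)
              ((∀ t : ℝ, (∃ x ∈ I, ∃ y ∈ I, t = ℓ x - ℓ y) →
                  G₀ t = C * Real.log (Real.cosh (D * t))) ∧
                (∀ x ∈ I, ℓ x = Real.log |Real.tan (α * x + β)| / (2 * D) + E ∧
                  H x = C * Real.log |Real.sin (2 * α * x + 2 * β)| + A * x + B) ∧
                (∀ x ∈ I, ∀ n : ℤ, 2 * (α * x + β) / Real.pi ≠ (n : ℝ))) ∨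
              -- case (vi)
              ((∀ t : ℝ, (∃ x ∈ I, ∃ y ∈ I, t = ℓ x - ℓ y) →
                  G₀ t = C * Real.log (Real.cosh (D * t))) ∧
                (∀ x ∈ I, ℓ x = Real.log |Real.tanh (α * x + β)| / (2 * D) + E ∧
                  H x = C * Real.log |Real.sinh (2 * α * x + 2 * β)| + A * x + B) ∧
                (∀ x ∈ I, α * x + β ≠ 0)) ∨
              -- case (vii)
              ((∀ t : ℝ, (∃ x ∈ I, ∃ y ∈ I, t = ℓ x - ℓ y) →
                  G₀ t = C * Real.log (Real.cos (D * t))) ∧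
                (∀ x ∈ I, ℓ x = Real.arctan (Real.tanh (α * x + β)) / D + E ∧
                  H x = C * Real.log (Real.cosh (2 * α * x + 2 * β)) + A * x + B))))) := by
  constructor
  · intro h
    have hℓd : ∀ x ∈ I, HasDerivAt ℓ (1 / (deriv ℓ x)⁻¹) x := fun x hx => by
      simpa using (hℓ x hx).hasDerivAt
    have hHd : ∀ x ∈ I, HasDerivAt H (deriv H x) x := fun x hx => (hH x hx).hasDerivAt
    have hmean := isMidpointMean_inv_deriv hIopen hIconn (fun x hx => (hℓ x hx).hasDerivAt) hHd
      (fun x hx y hy => hG₀ _ ⟨x, hx, y, hy, rfl⟩) hℓ' h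
    have hsign := hasDerivWithinAt_forall_lt_or_forall_gt_of_forall_ne hIconn.convex
      (fun x hx => (hℓ x hx).hasDerivAt.hasDerivWithinAt) hℓ'
    have hf0 : ∀ x ∈ I, (deriv ℓ x)⁻¹ ≠ 0 := fun x hx => inv_ne_zero (hℓ' x hx)
    have hode := hmean.exists_ode hIopen hIconn
      (hsign.imp (fun hs x hx => inv_lt_zero.2 (hs x hx)) fun hs x hx => inv_pos.2 (hs x hx))
      hH' hIne
    set f : ℝ → ℝ := fun x => (deriv ℓ x)⁻¹ with hf
    change ∀ x ∈ I, HasDerivAt ℓ (1 / f x) x at hℓd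
    change ∀ x ∈ I, f x ≠ 0 at hf0
    obtain ⟨a₀, ha₀⟩ := hIne
    rcases hode with ⟨A, hA⟩ | ⟨f₁, γ, c, hc0, h1, h2, h3⟩
    · obtain ⟨B, hB⟩ := exists_eq_add_const_of_hasDerivAt hIopen hIconn hHd
        (v := fun x => A * x) (fun x hx => by
          simpa [hA x hx] using (hasDerivAt_id x).const_mul A)
      refine ⟨A, B, 0, 0, 0, 0, 0, Or.inl ⟨?_, hB⟩⟩
      rintro t ⟨x, hx, y, hy, rfl⟩
      rw [h x hx y hy, hB x hx, hB y hy, hB _ (midpoint_mem hIconn hx hy)]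
      ring
    have hc1 : -c ≠ 0 := neg_ne_zero.2 hc0
    rcases lt_trichotomy γ 0 with hγ | rfl | hγ
    · obtain ⟨k, hk, rfl⟩ : ∃ k : ℝ, k ≠ 0 ∧ γ = -k ^ 2 :=
        ⟨√(-γ), (Real.sqrt_pos.2 (by linarith)).ne', by rw [Real.sq_sqrt (by linarith)]; ring⟩
      obtain ⟨R, δ, hR⟩ := eq_sin_of_ode hIopen hIconn hk h1 h2
      have hR' : ∀ x ∈ I, f x = R * Real.sin (2 * (k / 2) * x + 2 * (δ / 2)) := fun x hx => by
        rw [hR x hx]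
        congr 2
        ring
      have hR0 : R ≠ 0 := by
        rintro rfl
        exact hf0 a₀ ha₀ (by rw [hR a₀ ha₀, zero_mul])
      have hs0 : ∀ x ∈ I, Real.sin (2 * (k / 2) * x + 2 * (δ / 2)) ≠ 0 := fun x hx h0 =>
        hf0 x hx (by rw [hR' x hx, h0, mul_zero])
      obtain ⟨A, B, E, hABE⟩ := eq_log_tan hIopen hIconn hℓd hHd h3 hR0
        (div_ne_zero hk two_ne_zero) hs0 hR'
      have hs0' : ∀ x ∈ I, Real.sin (2 * (k / 2 * x + δ / 2)) ≠ 0 := fun x hx => by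
        convert hs0 x hx using 2
        ring
      refine ⟨A, B, _, k / 2 * R, E, k / 2, δ / 2, Or.inr ⟨?_,
        Or.inr (Or.inr (Or.inr (Or.inl ⟨?_, hABE, ?_⟩)))⟩⟩
      · positivity
      · rintro t ⟨x, hx, y, hy, rfl⟩
        rw [h x hx y hy]
        exact midpoint_gap_tan hIconn (by positivity) hABE hs0' hx hy
      · intro x hx n hn
        refine hs0' x hx (Real.sin_eq_zero_iff.2 ⟨n, ?_⟩)
        rw [← hn]
        field_simp
    · obtain ⟨a, b, hab⟩ := eq_affine_of_ode hIopen hIconn h1 (by simpa using h2)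
      rcases eq_or_ne a 0 with rfl | ha
      · have hb : b ≠ 0 := by
          rintro rfl
          exact hf0 a₀ ha₀ (by rw [hab a₀ ha₀]; simp)
        obtain ⟨A, B, E, hABE⟩ := eq_quadratic hIopen hIconn hℓd hHd h3 hb
          (by simpa using hab)
        refine ⟨A, B, _, b / 2, E, 1, 0, Or.inr ⟨?_, Or.inl ⟨?_, hABE⟩⟩⟩
        · positivity
        · rintro t ⟨x, hx, y, hy, rfl⟩
          rw [h x hx y hy]
          exact midpoint_gap_quadratic hIconn (by positivity) hABE hx hy
      · have h0 : ∀ x ∈ I, a * x + b ≠ 0 := fun x hx => hab x hx ▸ hf0 x hx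
        obtain ⟨A, B, E, hABE⟩ := eq_log hIopen hIconn hℓd hHd h3 ha h0 hab
        refine ⟨A, B, _, a / 2, E, a, b, Or.inr ⟨?_,
          Or.inr (Or.inr (Or.inl ⟨?_, hABE, h0⟩))⟩⟩
        · positivity
        · rintro t ⟨x, hx, y, hy, rfl⟩
          rw [h x hx y hy]
          exact midpoint_gap_log hIconn (by positivity) hABE h0 hx hy
    · obtain ⟨k, hk, rfl⟩ : ∃ k : ℝ, k ≠ 0 ∧ γ = k ^ 2 :=
        ⟨√γ, (Real.sqrt_pos.2 hγ).ne', by rw [Real.sq_sqrt hγ.le]⟩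
      obtain ⟨a, b, hab⟩ := eq_exp_of_ode hIopen hIconn hk h1 h2
      rcases lt_trichotomy (a * b) 0 with hneg | hzero | hpos
      · obtain ⟨R, δ, hR⟩ := exp_add_exp_eq_sinh hneg
        have hR' : ∀ x ∈ I, f x = R * Real.sinh (2 * (k / 2) * x + 2 * (δ / 2)) := fun x hx => by
          rw [hab x hx, neg_mul, hR]
          congr 2
          ring
        have hs0 : ∀ x ∈ I, Real.sinh (2 * (k / 2) * x + 2 * (δ / 2)) ≠ 0 := fun x hx h0 =>
          hf0 x hx (by rw [hR' x hx, h0, mul_zero])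
        have hR0 : R ≠ 0 := by
          rintro rfl
          exact hf0 a₀ ha₀ (by rw [hR' a₀ ha₀, zero_mul])
        have h0 : ∀ x ∈ I, k / 2 * x + δ / 2 ≠ 0 := fun x hx h0 => hs0 x hx (by
          rw [show 2 * (k / 2) * x + 2 * (δ / 2) = 2 * (k / 2 * x + δ / 2) by ring, h0]
          simp)
        obtain ⟨A, B, E, hABE⟩ := eq_log_tanh hIopen hIconn hℓd hHd h3 hR0
          (div_ne_zero hk two_ne_zero) hs0 hR'
        refine ⟨A, B, _, k / 2 * R, E, k / 2, δ / 2, Or.inr ⟨?_,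
          Or.inr (Or.inr (Or.inr (Or.inr (Or.inl ⟨?_, hABE, h0⟩))))⟩⟩
        · positivity
        · rintro t ⟨x, hx, y, hy, rfl⟩
          rw [h x hx y hy]
          exact midpoint_gap_tanh hIconn (by positivity) hABE h0 hx hy
      · obtain ⟨α, b', hα, hfb⟩ : ∃ α b' : ℝ, α ≠ 0 ∧ ∀ x ∈ I, f x = b' * Real.exp (-α * x) := by
          rcases mul_eq_zero.1 hzero with rfl | rfl
          · exact ⟨k, b, hk, fun x hx => by rw [hab x hx]; simp⟩
          · exact ⟨-k, a, neg_ne_zero.2 hk, fun x hx => by rw [hab x hx]; simp⟩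
        have hb : b' ≠ 0 := by
          rintro rfl
          exact hf0 a₀ ha₀ (by rw [hfb a₀ ha₀, zero_mul])
        obtain ⟨A, B, E, hABE⟩ := eq_exp hIopen hIconn hℓd hHd h3 hb hα hfb
        refine ⟨A, B, _, _, E, α, 0, Or.inr ⟨?_, Or.inr (Or.inl ⟨?_, hABE⟩)⟩⟩
        · positivity
        · rintro t ⟨x, hx, y, hy, rfl⟩
          rw [h x hx y hy]
          exact midpoint_gap_exp hIconn (by positivity) hABE hx hy
      · obtain ⟨R, δ, hR⟩ := exp_add_exp_eq_cosh hpos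
        have hR' : ∀ x ∈ I, f x = R * Real.cosh (2 * (k / 2) * x + 2 * (δ / 2)) := fun x hx => by
          rw [hab x hx, neg_mul, hR]
          congr 2
          ring
        have hR0 : R ≠ 0 := by
          rintro rfl
          exact hf0 a₀ ha₀ (by rw [hR' a₀ ha₀, zero_mul])
        obtain ⟨A, B, E, hABE⟩ := eq_arctan_tanh hIopen hIconn hℓd hHd h3 hR0
          (div_ne_zero hk two_ne_zero) hR'
        refine ⟨A, B, _, k / 2 * R, E, k / 2, δ / 2, Or.inr ⟨?_,
          Or.inr (Or.inr (Or.inr (Or.inr (Or.inr ⟨?_, hABE⟩))))⟩⟩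
        · positivity
        · rintro t ⟨x, hx, y, hy, rfl⟩
          rw [h x hx y hy]
          exact midpoint_gap_arctan_tanh hIconn (by positivity) hABE hx hy
  · rintro ⟨A, B, C, D, E, α, β, ⟨hG, hAB⟩ | ⟨hCD, hcases⟩⟩ x hx y hy
    · rw [hG _ ⟨x, hx, y, hy, rfl⟩, hAB x hx, hAB y hy, hAB _ (midpoint_mem hIconn hx hy)]
      ring
    have hD : D ≠ 0 := right_ne_zero_of_mul (left_ne_zero_of_mul hCD)
    rcases hcases with ⟨hG, hf⟩ | ⟨hG, hf⟩ | ⟨hG, hf, h0⟩ | ⟨hG, hf, h0⟩ | ⟨hG, hf, h0⟩ |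
      ⟨hG, hf⟩ <;> rw [hG _ ⟨x, hx, y, hy, rfl⟩]
    · exact (midpoint_gap_quadratic hIconn hD hf hx hy).symm
    · exact (midpoint_gap_exp hIconn hD hf hx hy).symm
    · exact (midpoint_gap_log hIconn hD hf h0 hx hy).symm
    · refine (midpoint_gap_tan hIconn hD hf (fun z hz hsin => ?_) hx hy).symm
      obtain ⟨n, hn⟩ := Real.sin_eq_zero_iff.1 hsin
      exact h0 z hz n (by rw [← hn]; field_simp)
    · exact (midpoint_gap_tanh hIconn hD hf h0 hx hy).symm
    · exact (midpoint_gap_arctan_tanh hIconn hD hf hx hy).symm
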